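/- arXiv:2504.12153 — 4 statements merged into one kernel-verified Lean document; each statement's English description precedes it below -/
import Mathlib

section
/- Let ρ_max > 0 and q* > 0 be real constants. For any ρ ∈ (0, ρ_max) and q > 0, the two eigenvalues λ₁(ρ,q) = (q − q*)(1/ρ − 2/ρ_max) − q*/ρ_max and λ₂(ρ,q) = V_c(ρ,q) = (1 − ρ/ρ_max) q/ρ of the congested-phase Jacobian satisfy the strict ordering λ₁(ρ,q) < λ₂(ρ,q); in fact λ₁(ρ,q) − λ₂(ρ,q) = −q*(1/ρ − 1/ρ_max) − q/ρ_max < 0. In particular the congested-phase system is strictly hyperbolic on this set. -/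
/-- Congested-phase traffic speed `V_c(ρ,q) = (1 - ρ/ρ_max) q/ρ`. -/
noncomputable def Vc (ρmax ρ q : ℝ) : ℝ := (1 - ρ / ρmax) * q / ρ

/-- First eigenvalue `λ₁(ρ,q) = (q - q*)(1/ρ - 2/ρ_max) - q*/ρ_max`. -/
noncomputable def lam1 (ρmax qs ρ q : ℝ) : ℝ := (q - qs) * (1 / ρ - 2 / ρmax) - qs / ρmax

theorem stmt_1 (ρmax qs : ℝ) (hρmax : 0 < ρmax) (hqs : 0 < qs)
    (ρ q : ℝ) (hρ : 0 < ρ) (hρ' : ρ < ρmax) (hq : 0 < q) :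
    lam1 ρmax qs ρ q - Vc ρmax ρ q = -qs * (1 / ρ - 1 / ρmax) - q / ρmax ∧
    lam1 ρmax qs ρ q - Vc ρmax ρ q < 0 ∧
    lam1 ρmax qs ρ q < Vc ρmax ρ q := by
  have difference :
      lam1 ρmax qs ρ q - Vc ρmax ρ q = -qs * (1 / ρ - 1 / ρmax) - q / ρmax := by
    unfold lam1 Vc
    field_simp
    ring
  have negative : lam1 ρmax qs ρ q - Vc ρmax ρ q < 0 := by
    have : 0 < qs * (1 / ρ - 1 / ρmax) :=
      mul_pos hqs (sub_pos.2 (one_div_lt_one_div_of_lt hρ hρ'))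
    have : 0 < q / ρmax := div_pos hq hρmax
    linarith
  exact ⟨difference, negative, sub_neg.1 negative⟩
end

section
/- Let ρ_max > 0 and q* > 0 be real constants. For any ρ ∈ (0, ρ_max) and q > 0, both characteristic speeds of the congested-phase system do not exceed the traffic speed: λ₁(ρ,q) < V_c(ρ,q) and λ₂(ρ,q) = V_c(ρ,q), where λ₁(ρ,q) = (q − q*)(1/ρ − 2/ρ_max) − q*/ρ_max, λ₂(ρ,q) = V_c(ρ,q), and V_c(ρ,q) = (1 − ρ/ρ_max) q/ρ. This is the anisotropy (causality) property: traffic waves generated by the model do not travel faster than the average traffic speed. -/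
/-- Second eigenvalue `λ₂(ρ,q) = V_c(ρ,q)`. -/
noncomputable def lam2 (ρmax ρ q : ℝ) : ℝ := Vc ρmax ρ q

/-- The gap between the traffic speed and the first characteristic speed. -/
theorem Vc_sub_lam1 {ρmax ρ : ℝ} (hρmax : ρmax ≠ 0) (hρ : ρ ≠ 0) (qs q : ℝ) :
    Vc ρmax ρ q - lam1 ρmax qs ρ q = q / ρmax + qs * (1 / ρ - 1 / ρmax) := by
  unfold Vc lam1
  field_simp
  ring

theorem stmt_2 (ρmax qs : ℝ) (hρmax : 0 < ρmax) (hqs : 0 < qs)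
    (ρ q : ℝ) (hρ : 0 < ρ) (hρ' : ρ < ρmax) (hq : 0 < q) :
    lam1 ρmax qs ρ q < Vc ρmax ρ q ∧ lam2 ρmax ρ q = Vc ρmax ρ q := by
  refine ⟨?_, rfl⟩
  rw [← sub_pos, Vc_sub_lam1 hρmax.ne' hρ.ne']
  have h : 0 < 1 / ρ - 1 / ρmax := sub_pos.2 (one_div_lt_one_div_of_lt hρ hρ')
  positivity
end

section
/- Let ρ_max > 0 and q* be real constants, and on the set {(ρ,q) : 0 < ρ < ρ_max, q ≠ q*} define λ₁(ρ,q) = (q − q*)(1/ρ − 2/ρ_max) − q*/ρ_max and r₁(ρ,q) = (ρ/(q − q*), 1)ᵀ. Then the first characteristic field is genuinely nonlinear: the directional derivative of λ₁ along r₁ satisfies ∇λ₁(ρ,q) · r₁(ρ,q) = (∂λ₁/∂ρ) · ρ/(q − q*) + ∂λ₁/∂q = −2/ρ_max ≠ 0 at every such point. -/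
/-- First eigenvalue `λ₁` of the congested-phase Jacobian, as a function on `ℝ × ℝ`. -/
noncomputable def lam1Fun (ρmax qs : ℝ) : ℝ × ℝ → ℝ :=
  fun p => (p.2 - qs) * (1 / p.1 - 2 / ρmax) - qs / ρmax

theorem hasFDerivAt_lam1Fun (ρmax qs : ℝ) {p : ℝ × ℝ} (hp : p.1 ≠ 0) :
    HasFDerivAt (lam1Fun ρmax qs)
      ((p.2 - qs) • (-(p.1 ^ 2)⁻¹ • ContinuousLinearMap.fst ℝ ℝ ℝ) +
        (p.1⁻¹ - 2 / ρmax) • ContinuousLinearMap.snd ℝ ℝ ℝ) p := by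
  have h := ((hasFDerivAt_snd (𝕜 := ℝ) (p := p)).sub_const qs).mul
    (((hasDerivAt_inv hp).comp_hasFDerivAt p (hasFDerivAt_fst (𝕜 := ℝ))).sub_const (2 / ρmax))
  have hfun : lam1Fun ρmax qs =
      fun x : ℝ × ℝ => (x.2 - qs) * (x.1⁻¹ - 2 / ρmax) - qs / ρmax := by
    funext x
    simp [lam1Fun]
  rw [hfun]
  exact h.sub_const (qs / ρmax)

theorem stmt_9 (ρmax qs : ℝ) (hρmax : 0 < ρmax)
    (ρ q : ℝ) (hρ : 0 < ρ) (hρ' : ρ < ρmax) (hq : q ≠ qs) :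
    fderiv ℝ (lam1Fun ρmax qs) (ρ, q) (ρ / (q - qs), 1) = -2 / ρmax ∧
    (-2 / ρmax : ℝ) ≠ 0 := by
  refine ⟨?_, div_ne_zero (by norm_num) hρmax.ne'⟩
  rw [(hasFDerivAt_lam1Fun ρmax qs (p := (ρ, q)) hρ.ne').fderiv]
  have hq' : q - qs ≠ 0 := sub_ne_zero.mpr hq
  simp only [add_apply, smul_apply,
    ContinuousLinearMap.coe_fst', ContinuousLinearMap.coe_snd', smul_eq_mul]
  field_simp
  ring
end

section
/- Let ρ_max > 0 be a real constant, and on the set {(ρ,q) : 0 < ρ < ρ_max, q ≠ 0} define λ₂(ρ,q) = V_c(ρ,q) = (1 − ρ/ρ_max) q/ρ and r₂(ρ,q) = (ρ(ρ_max − ρ)/(q ρ_max), 1)ᵀ. Then the second characteristic field is linearly degenerate: the directional derivative of λ₂ along r₂ vanishes identically, i.e. ∇λ₂(ρ,q) · r₂(ρ,q) = (∂V_c/∂ρ) · ρ(ρ_max − ρ)/(q ρ_max) + ∂V_c/∂q = 0 at every such point. Consequently λ₂-waves are contact discontinuities. -/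
/-- Second eigenvalue `λ₂(ρ,q) = V_c(ρ,q) = (1 - ρ/ρ_max) q/ρ`, as a function on `ℝ × ℝ`. -/
noncomputable def lam2Fun (ρmax : ℝ) : ℝ × ℝ → ℝ :=
  fun p => (1 - p.1 / ρmax) * p.2 / p.1

theorem hasFDerivAt_lam2Fun (ρmax : ℝ) {p : ℝ × ℝ} (hp : p.1 ≠ 0) :
    HasFDerivAt (lam2Fun ρmax)
      ((-p.2 / p.1 ^ 2) • ContinuousLinearMap.fst ℝ ℝ ℝ +
        ((1 - p.1 / ρmax) / p.1) • ContinuousLinearMap.snd ℝ ℝ ℝ) p := by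
  have hfst : HasFDerivAt (fun x : ℝ × ℝ => x.1) (ContinuousLinearMap.fst ℝ ℝ ℝ) p :=
    hasFDerivAt_fst
  have hsnd : HasFDerivAt (fun x : ℝ × ℝ => x.2) (ContinuousLinearMap.snd ℝ ℝ ℝ) p :=
    hasFDerivAt_snd
  have hinv := (hasDerivAt_inv hp).comp_hasFDerivAt p hfst
  have h := (((hfst.mul_const ρmax⁻¹).const_sub 1).mul hsnd).mul hinv
  refine (h.congr_fderiv ?_).congr_of_eventuallyEq (.of_forall fun x => ?_)
  · ext <;> simp <;> field_simp <;> ring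
  · simp [lam2Fun, div_eq_mul_inv]

theorem stmt_10 (ρmax : ℝ) (hρmax : 0 < ρmax)
    (ρ q : ℝ) (hρ : 0 < ρ) (hρ' : ρ < ρmax) (hq : q ≠ 0) :
    fderiv ℝ (lam2Fun ρmax) (ρ, q) (ρ * (ρmax - ρ) / (q * ρmax), 1) = 0 := by
  rw [(hasFDerivAt_lam2Fun ρmax (p := (ρ, q)) hρ.ne').fderiv]
  simp
  field_simp
  ring
end
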